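/- Every word w ∈ E⁺ is equivalent in IG(E) to a word in reduced form: there exists w′ ∈ E⁺ with w̄ = w̄′ such that w′ admits a minimal r-factorisation w′ = p₁⋯pₘ in which, for every 1 ≤ i ≤ m and every letter e occurring in pᵢ, one has ē 𝓓 p̄ᵢ in IG(E) (equivalently, every letter occurrence in each factor pᵢ is a seed of pᵢ). -/

import Mathlib

section Green

variable {T : Type*} [Semigroup T]

/-- Green's relation 𝓡. -/
def GreenR (a b : T) : Prop := a = b ∨ ∃ x y : T, a * x = b ∧ b * y = a

/-- Green's relation 𝓛. -/
def GreenL (a b : T) : Prop := a = b ∨ ∃ x y : T, x * a = b ∧ y * b = a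

/-- Green's relation 𝓓 = 𝓡 ∘ 𝓛. -/
def GreenD (a b : T) : Prop := ∃ c : T, GreenR a c ∧ GreenL c b

/-- An element is regular if `a = a * b * a` for some `b`. -/
def IsRegularElem (a : T) : Prop := ∃ b : T, a * b * a = a

/-- The principal two-sided ideal `T¹ a T¹`. -/
def principalIdeal (a : T) : Set T :=
  {x | x = a ∨ (∃ u, u * a = x) ∨ (∃ v, a * v = x) ∨ ∃ u v, u * a * v = x}

/-- Green's relation 𝓙. -/
def GreenJ (a b : T) : Prop := principalIdeal a = principalIdeal b

/-- The 𝓙-preorder. -/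
def JleRel (a b : T) : Prop := principalIdeal a ⊆ principalIdeal b

/-- Strict 𝓙-order. -/
def JltRel (a b : T) : Prop := JleRel a b ∧ ¬ JleRel b a

/-- `u` is a (two-sided) identity element. -/
def IsIdentityElem (u : T) : Prop := ∀ x : T, u * x = x ∧ x * u = x

/-- The relation 𝓡̃. -/
def RTilde (a b : T) : Prop := ∀ ε : T, ε * ε = ε → (ε * a = a ↔ ε * b = b)

/-- The relation 𝓛̃. -/
def LTilde (a b : T) : Prop := ∀ ε : T, ε * ε = ε → (a * ε = a ↔ b * ε = b)

/-- `blockProd p i k = p i * p (i+1) * ⋯ * p (i+k)`. -/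
def blockProd (p : ℕ → T) (i : ℕ) : ℕ → T
  | 0 => p i
  | k + 1 => blockProd p i k * p (i + (k + 1))

/-- Multiply `x` by optional (possibly empty) words on both sides. -/
def withCtx (u : Option T) (x : T) (v : Option T) : T :=
  match u, v with
  | none, none => x
  | some u', none => u' * x
  | none, some v' => x * v'
  | some u', some v' => u' * x * v'

/-- Multiply by an optional word on the left. -/
def leftCtx (u : Option T) (x : T) : T := match u with | none => x | some u' => u' * x

/-- Multiply by an optional word on the right. -/
def rightCtx (x : T) (v : Option T) : T := match v with | none => x | some v' => x * v'

end Green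

section IGdef

/-- The set of idempotents of `S`. -/
abbrev IdemE (S : Type*) [Semigroup S] : Type _ := {x : S // x * x = x}

variable {S : Type*} [Semigroup S]

/-- `e, f` form a basic pair if `{e,f} ∩ {ef,fe} ≠ ∅`. -/
def BasicPair (e f : IdemE S) : Prop :=
  (e : S) * f = e ∨ (e : S) * f = f ∨ (f : S) * e = e ∨ (f : S) * e = f

/-- The defining relations of IG(E): `ef = g` whenever `e, f` is a basic pair with
product `g` in `S`. -/
def igRelBase (u v : FreeSemigroup (IdemE S)) : Prop :=
  ∃ e f g : IdemE S, BasicPair e f ∧ (g : S) = (e : S) * (f : S) ∧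
    u = FreeSemigroup.of e * FreeSemigroup.of f ∧ v = FreeSemigroup.of g

/-- The congruence on the free semigroup `E⁺` generated by the defining relations. -/
def igCon (S : Type*) [Semigroup S] : Con (FreeSemigroup (IdemE S)) :=
  conGen (fun u v => igRelBase u v)

/-- The free idempotent generated semigroup IG(E). -/
abbrev IG (S : Type*) [Semigroup S] := (igCon S).Quotient

/-- `w̄`, the image of a word `w ∈ E⁺` in IG(E). -/
def igBar (w : FreeSemigroup (IdemE S)) : IG S := (w : (igCon S).Quotient)

/-- The list of letters of a word. -/
def wordList (w : FreeSemigroup (IdemE S)) : List (IdemE S) := w.head :: w.tail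

/-- The length of a word. -/
def wlen (w : FreeSemigroup (IdemE S)) : ℕ := (wordList w).length

/-- Length of an optional word. -/
def olen (u : Option (FreeSemigroup (IdemE S))) : ℕ :=
  match u with | none => 0 | some u' => wlen u'

/-- `p 1, …, p m` is an r-factorisation of `w`: each factor represents a regular
element of IG(E). -/
def IsRFact (w : FreeSemigroup (IdemE S)) (m : ℕ) (p : ℕ → FreeSemigroup (IdemE S)) : Prop :=
  1 ≤ m ∧ blockProd p 1 (m - 1) = w ∧ ∀ i, 1 ≤ i → i ≤ m → IsRegularElem (igBar (p i))

/-- A minimal r-factorisation: no product of two or more consecutive factors is regular. -/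
def IsMinRFact (w : FreeSemigroup (IdemE S)) (m : ℕ) (p : ℕ → FreeSemigroup (IdemE S)) : Prop :=
  IsRFact w m p ∧
    ∀ i j, 1 ≤ i → i < j → j ≤ m → ¬ IsRegularElem (igBar (blockProd p i (j - i)))

/-- The relation ≈ on m-tuples of words. -/
def TupleApprox (m : ℕ) (p q : ℕ → FreeSemigroup (IdemE S)) : Prop :=
  (∃ i, 1 ≤ i ∧ i ≤ m ∧ igBar (p i) = igBar (q i) ∧
    ∀ j, 1 ≤ j → j ≤ m → j ≠ i → p j = q j) ∨
  (∃ i, ∃ e : IdemE S, 1 ≤ i ∧ i < m ∧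
    igBar (p i) = igBar (q i * FreeSemigroup.of e) ∧
    igBar (q (i + 1)) = igBar (FreeSemigroup.of e * p (i + 1)) ∧
    ∀ j, 1 ≤ j → j ≤ m → j ≠ i → j ≠ i + 1 → p j = q j) ∨
  (∃ i, ∃ e : IdemE S, 1 ≤ i ∧ i < m ∧
    igBar (q i) = igBar (p i * FreeSemigroup.of e) ∧
    igBar (p (i + 1)) = igBar (FreeSemigroup.of e * q (i + 1)) ∧
    ∀ j, 1 ≤ j → j ≤ m → j ≠ i → j ≠ i + 1 → p j = q j)

/-- The relation ∼: the transitive closure of ≈. -/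
def TupleSim (m : ℕ) (p q : ℕ → FreeSemigroup (IdemE S)) : Prop :=
  Relation.TransGen (TupleApprox m) p q

/-- One application of a defining relation of IG(E) inside a word. -/
def RewriteStep (w w' : FreeSemigroup (IdemE S)) : Prop :=
  ∃ (u v : Option (FreeSemigroup (IdemE S))) (x y : FreeSemigroup (IdemE S)),
    (igRelBase x y ∨ igRelBase y x) ∧ w = withCtx u x v ∧ w' = withCtx u y v

/-- `e` is a seed of `w` at (1-based) position `k`. -/
def SeedAt (w : FreeSemigroup (IdemE S)) (e : IdemE S) (k : ℕ) : Prop :=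
  ∃ u v : Option (FreeSemigroup (IdemE S)),
    w = withCtx u (FreeSemigroup.of e) v ∧ k = olen u + 1 ∧
    GreenL (igBar (leftCtx u (FreeSemigroup.of e))) (igBar (FreeSemigroup.of e)) ∧
    GreenR (igBar (FreeSemigroup.of e)) (igBar (rightCtx (FreeSemigroup.of e) v))

/-- The coordinate (position within `w` of the first letter) of the `i`-th factor. -/
def wcoord (p : ℕ → FreeSemigroup (IdemE S)) (i : ℕ) : ℕ :=
  1 + ∑ j ∈ Finset.Ico 1 i, wlen (p j)

end IGdef

section Stability

variable {M : Type*} [Monoid M]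

/-- A monoid with finitely many idempotents contains no bicyclic submonoid. -/
theorem mul_eq_of_finite_idempotents (hfin : {x : M | x * x = x}.Finite) {e a b : M}
    (hae : a * e = a) (heb : e * b = b) (hbe : b * e = b)
    (hee : e * e = e) (hab : a * b = e) : b * a = e := by
  let c : ℕ → M := fun n => Nat.rec e (fun _ x => b * x * a) n
  have c0 : c 0 = e := rfl
  have cs : ∀ n, c (n + 1) = b * c n * a := fun n => rfl
  have hec : ∀ n, e * c n = c n := by
    rintro (_ | n)
    · rw [c0, hee]
    · rw [cs, ← mul_assoc, ← mul_assoc, heb]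
  have hce : ∀ n, c n * e = c n := by
    rintro (_ | n)
    · rw [c0, hee]
    · rw [cs, mul_assoc, hae]
  have hidem : ∀ n, c n * c n = c n := by
    intro n
    induction n with
    | zero => rw [c0, hee]
    | succ n ih =>
      calc c (n + 1) * c (n + 1) = b * (c n * (a * b) * c n) * a := by simp only [cs, mul_assoc]
        _ = c (n + 1) := by rw [hab, hce, ih, cs]
  have hcancel : ∀ n, a * c (n + 1) * b = c n := by
    intro n
    calc a * c (n + 1) * b = (a * b) * c n * (a * b) := by simp only [cs, mul_assoc]
      _ = c n := by rw [hab, hec, hce]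
  have hdesc : ∀ m k, c m = c (m + k) → c 0 = c k := by
    intro m k
    induction m with
    | zero => intro h; rwa [zero_add] at h
    | succ m ih =>
      intro h
      apply ih
      rw [← hcancel m, h, add_right_comm, hcancel]
  have hnot : ¬ Function.Injective c := fun hinj =>
    Set.infinite_of_injective_forall_mem hinj hidem hfin
  obtain ⟨k, hk⟩ : ∃ k, c 0 = c (k + 1) := by
    simp only [Function.Injective, not_forall] at hnot
    obtain ⟨m, n, h, hne⟩ := hnot
    rcases lt_or_gt_of_ne hne with hlt | hlt
    · obtain ⟨k, rfl⟩ := Nat.exists_eq_add_of_lt hlt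
      exact ⟨k, hdesc m (k + 1) h⟩
    · obtain ⟨k, rfl⟩ := Nat.exists_eq_add_of_lt hlt
      exact ⟨k, hdesc n (k + 1) h.symm⟩
  rw [c0, cs] at hk
  calc b * a = b * a * e := by rw [mul_assoc, hae]
    _ = b * (a * b) * c k * a := by conv_lhs => rw [hk]
                                    simp only [mul_assoc]
    _ = e := by rw [hab, hbe, ← hk]

/-- In a monoid with finitely many idempotents, if an idempotent `e` lies in the ideal generated
by `u * e * v` then `u * e 𝓛 e 𝓡 e * v`. -/
theorem stable_of_finite_idempotents (hfin : {x : M | x * x = x}.Finite) {e u v x y : M}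
    (hee : e * e = e) (h : x * (u * e * v) * y = e) :
    (∃ s, s * u * e = e) ∧ ∃ t, e * v * t = e := by
  have key := mul_eq_of_finite_idempotents hfin (e := e) (a := e * x * u * e) (b := e * v * y * e)
    (by simp only [mul_assoc, hee]) (by simp only [← mul_assoc, hee])
    (by simp only [mul_assoc, hee]) hee
    (by
      calc e * x * u * e * (e * v * y * e) = e * (x * (u * (e * e) * v) * y) * e := by
            simp only [mul_assoc]
        _ = e := by rw [hee, h, hee, hee])
  refine ⟨⟨e * v * y * (e * e) * x, ?_⟩, ⟨y * (e * e) * x * u * e, ?_⟩⟩ <;>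
    simpa only [mul_assoc] using key

end Stability

section SeededWords

variable {M : Type*} [Monoid M] {N : M → Prop}

/-- `l` has a letter `e` satisfying `N` with `u * e 𝓛 e 𝓡 e * v` in `M`, where `l = u e v`. -/
def Seeded (N : M → Prop) (l : List M) : Prop :=
  ∃ u e v, l = u ++ e :: v ∧ N e ∧ (∃ x, x * u.prod * e = e) ∧ ∃ y, e * v.prod * y = e

/-- `l` is a concatenation of at most `K` seeded words. -/
def SeededFact (N : M → Prop) (K : ℕ) (l : List M) : Prop :=
  ∃ L : List (List M), L.length ≤ K ∧ L.flatten = l ∧ ∀ q ∈ L, Seeded N q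

/-- `N` is closed upwards in the 𝓙-order. -/
def JUpward (N : M → Prop) : Prop := ∀ g x y, N (x * g * y) → N g

theorem JUpward.of_eq (hN : JUpward N) {e : M} (he : N e) (g x y : M) (h : x * g * y = e) :
    N g := hN g x y (h ▸ he)

theorem append_cons_eq_append_cons {α : Type*} {u v u' v' : List α} {a e : α}
    (h : u ++ a :: v = u' ++ e :: v') :
    (∃ t, u = u' ++ e :: t ∧ v' = t ++ a :: v) ∨ (u = u' ∧ a = e ∧ v = v') ∨
      ∃ t, u' = u ++ a :: t ∧ v = t ++ e :: v' := by
  rcases List.append_eq_append_iff.1 h with ⟨t, rfl, h2⟩ | ⟨t, rfl, h2⟩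
  · rcases t with _ | ⟨b, t⟩
    · simp at h2; simp [h2]
    · simp at h2; right; right; exact ⟨t, by simp [h2.1], h2.2⟩
  · rcases t with _ | ⟨b, t⟩
    · simp at h2; simp [h2]
    · simp at h2; left; exact ⟨t, by simp [h2.1], h2.2⟩

theorem Seeded.contract (hN : JUpward N) {u v : List M} {a b : M}
    (h : Seeded N (u ++ a :: b :: v)) : Seeded N (u ++ (a * b) :: v) := by
  obtain ⟨u', e, v', h, he, ⟨x, hx⟩, y, hy⟩ := h
  rcases append_cons_eq_append_cons h with ⟨t, rfl, rfl⟩ | ⟨rfl, rfl, rfl⟩ | ⟨t, rfl, ht⟩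
  · refine ⟨u', e, t ++ (a * b) :: v, by simp, he, ⟨x, hx⟩, y, ?_⟩
    simpa [mul_assoc] using hy
  · simp only [List.prod_cons] at hy
    refine ⟨u, a * b, v, rfl, hN.of_eq he _ 1 (v.prod * y) ?_, ⟨x, ?_⟩, y * b, ?_⟩
    · simpa only [one_mul, mul_assoc] using hy
    · rw [← mul_assoc, hx]
    · calc a * b * v.prod * (y * b) = (a * (b * v.prod) * y) * b := by simp only [mul_assoc]
        _ = a * b := by rw [hy]
  · rcases t with _ | ⟨c, t⟩
    · simp only [List.nil_append, List.cons.injEq] at ht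
      obtain ⟨rfl, rfl⟩ := ht
      simp only [List.prod_append, List.prod_singleton] at hx
      refine ⟨u, a * b, v, rfl, hN.of_eq he _ (x * u.prod) 1 ?_, ⟨a * x, ?_⟩, y, ?_⟩
      · simpa only [mul_one, mul_assoc] using hx
      · calc a * x * u.prod * (a * b) = a * (x * (u.prod * a) * b) := by simp only [mul_assoc]
          _ = a * b := by rw [hx]
      · rw [mul_assoc, mul_assoc, ← mul_assoc b, hy]
    · simp only [List.cons_append, List.cons.injEq] at ht
      obtain ⟨rfl, rfl⟩ := ht
      refine ⟨u ++ (a * b) :: t, e, v', by simp, he, ⟨x, ?_⟩, y, hy⟩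
      simpa [mul_assoc] using hx

/-- The condition on a basic pair of idempotents with product an idempotent. -/
structure IsBasic (a b : M) : Prop where
  left : a * a = a
  right : b * b = b
  basic : a * b = a ∨ a * b = b ∨ b * a = a ∨ b * a = b

theorem Seeded.expand (hN : JUpward N) {u v : List M} {a b : M} (hab : IsBasic a b)
    (h : Seeded N (u ++ (a * b) :: v)) : Seeded N (u ++ a :: b :: v) := by
  obtain ⟨u', e, v', h, he, ⟨x, hx⟩, y, hy⟩ := h
  rcases append_cons_eq_append_cons h with ⟨t, rfl, rfl⟩ | ⟨rfl, rfl, rfl⟩ | ⟨t, rfl, rfl⟩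
  · refine ⟨u', e, t ++ a :: b :: v, by simp, he, ⟨x, hx⟩, y, ?_⟩
    simpa [mul_assoc] using hy
  · have hNa : N a := hN.of_eq he a 1 b (by rw [one_mul])
    have hNb : N b := hN.of_eq he b a 1 (by rw [mul_one])
    rcases hab.basic with h | h | h | h
    · refine ⟨u, a, b :: v, rfl, hNa, ⟨x, by rwa [h] at hx⟩, y, ?_⟩
      rw [List.prod_cons, ← mul_assoc, hy, h]
    · refine ⟨u ++ [a], b, v, by simp, hNb, ⟨x, ?_⟩, y, by rwa [h] at hy⟩
      rw [List.prod_append, List.prod_singleton]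
      rw [← mul_assoc, mul_assoc, hx, h]
    · have haba : a * b * a = a := by rw [mul_assoc, h, hab.left]
      refine ⟨u, a, b :: v, rfl, hNa, ⟨x, ?_⟩, y * a, ?_⟩
      · rw [← haba, ← mul_assoc, hx]
      · rw [List.prod_cons, ← mul_assoc, ← mul_assoc, hy, haba]
    · have hbab : b * (a * b) = b := by rw [← mul_assoc, h, hab.right]
      refine ⟨u ++ [a], b, v, by simp, hNb, ⟨b * x, ?_⟩, y, ?_⟩
      · calc b * x * (u ++ [a]).prod * b = b * (x * u.prod * (a * b)) := by
              simp [mul_assoc]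
          _ = b := by rw [hx, hbab]
      · calc b * v.prod * y = b * (a * b) * v.prod * y := by rw [hbab]
          _ = b * (a * b * v.prod * y) := by simp only [mul_assoc]
          _ = b := by rw [hy, hbab]
  · refine ⟨u ++ a :: b :: t, e, v', by simp, he, ⟨x, ?_⟩, y, hy⟩
    simpa [mul_assoc] using hx

/-- Contracting a basic pair which straddles the boundary of two seeded words. -/
theorem Seeded.contract_boundary (hN : JUpward N) {u v : List M} {a b : M} (hab : IsBasic a b)
    (h₁ : Seeded N (u ++ [a])) (h₂ : Seeded N (b :: v)) :
    ∃ L : List (List M), L.length ≤ 2 ∧ L.flatten = u ++ (a * b) :: v ∧ ∀ q ∈ L, Seeded N q := by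
  have haba : b * a = a → a * b * a = a := fun h => by rw [mul_assoc, h, hab.left]
  have hbab : b * a = b → b * (a * b) = b := fun h => by rw [← mul_assoc, h, hab.right]
  have hcut : ∀ p q : List M, Seeded N p → Seeded N q → p ++ q = u ++ (a * b) :: v →
      ∃ L : List (List M), L.length ≤ 2 ∧ L.flatten = u ++ (a * b) :: v ∧
        ∀ q ∈ L, Seeded N q := by
    intro p q hp hq h
    exact ⟨[p, q], by simp, by simpa using h, by simp [hp, hq]⟩
  have hNc : N a → N b → N (a * b) := by
    intro ha hb
    rcases hab.basic with h | h | h | h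
    · rwa [h]
    · rwa [h]
    · exact hN.of_eq ha _ 1 a (by rw [one_mul, haba h])
    · exact hN.of_eq hb _ b 1 (by rw [mul_one, hbab h])
  have hseed₁ := h₁
  have hseed₂ := h₂
  obtain ⟨u', e, v', h₁, he, ⟨x, hx⟩, y, hy⟩ := h₁
  obtain ⟨u'', f, v'', h₂, hf, ⟨x', hx'⟩, y', hy'⟩ := h₂
  have hleft := append_cons_eq_append_cons h₁
  have hright := append_cons_eq_append_cons (u := []) h₂
  simp only [List.nil_append, List.nil_eq, List.append_eq_nil_iff, reduceCtorEq, and_false,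
    false_and, exists_false, false_or] at hright
  rcases hleft with ⟨t, rfl, rfl⟩ | ⟨rfl, rfl, rfl⟩ | ⟨t, -, ht⟩
  · have hu : Seeded N (u' ++ e :: t) := by
      refine ⟨u', e, t, rfl, he, ⟨x, hx⟩, a * y, ?_⟩
      simpa [mul_assoc] using hy
    have hNa : N a := hN.of_eq he a (e * t.prod) y (by simpa [mul_assoc] using hy)
    rcases hright with ⟨rfl, rfl, rfl⟩ | ⟨s, rfl, rfl⟩
    · refine hcut _ ((a * b) :: v) hu ⟨[], a * b, v, rfl, hNc hNa hf, ⟨1, by simp⟩, y', ?_⟩ rfl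
      rw [mul_assoc, mul_assoc, ← mul_assoc b, hy']
    · rcases hab.basic with h | h | h | h
      · refine hcut _ (s ++ f :: v'') hseed₁ ⟨s, f, v'', rfl, hf, ⟨x' * b, ?_⟩, y', hy'⟩
          (by simp [h])
        simpa [mul_assoc] using hx'
      · exact hcut _ _ hu hseed₂ (by simp [h])
      · refine hcut ((u' ++ e :: t) ++ [a * b]) (s ++ f :: v'')
          ⟨u', e, t ++ [a * b], by simp, he, ⟨x, hx⟩, a * y, ?_⟩
          ⟨s, f, v'', rfl, hf, ⟨x' * b, ?_⟩, y', hy'⟩ (by simp)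
        · calc e * (t ++ [a * b]).prod * (a * y) = e * (t.prod * (a * b * a)) * y := by
                simp [mul_assoc]
            _ = e := by rw [haba h]; simpa using hy
        · simpa [mul_assoc] using hx'
      · refine hcut _ ((a * b) :: (s ++ f :: v'')) hu
          ⟨(a * b) :: s, f, v'', rfl, hf, ⟨x' * b, ?_⟩, y', hy'⟩ rfl
        calc x' * b * ((a * b) :: s).prod * f = x' * ((b * (a * b)) * s.prod) * f := by
              simp [mul_assoc]
          _ = f := by rw [hbab h, ← List.prod_cons, hx']
  · have hxc : x * u.prod * (a * b) = a * b := by rw [← mul_assoc, hx]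
    rcases hright with ⟨rfl, rfl, rfl⟩ | ⟨s, rfl, rfl⟩
    · refine ⟨[u ++ (a * b) :: v], by simp, by simp, ?_⟩
      simp only [List.mem_singleton, forall_eq]
      refine ⟨u, a * b, v, rfl, hNc he hf, ⟨x, hxc⟩, y', ?_⟩
      rw [mul_assoc, mul_assoc, ← mul_assoc b, hy']
    · have hNb : N b := hN.of_eq hf b x' (s.prod * f) (by simpa [mul_assoc] using hx')
      refine hcut (u ++ [a * b]) (s ++ f :: v'')
        ⟨u, a * b, [], rfl, hNc he hNb, ⟨x, hxc⟩, 1, by simp⟩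
        ⟨s, f, v'', rfl, hf, ⟨x' * b, ?_⟩, y', hy'⟩ (by simp)
      simpa [mul_assoc] using hx'
  · simp at ht

theorem SeededFact.contract (hN : JUpward N) {K : ℕ} {u v : List M} {a b : M}
    (hab : IsBasic a b) (h : SeededFact N K (u ++ a :: b :: v)) :
    SeededFact N K (u ++ (a * b) :: v) := by
  obtain ⟨L, hlen, hflat, hL⟩ := h
  induction L generalizing u K with
  | nil => simp at hflat
  | cons q L ih =>
    obtain ⟨K, rfl⟩ : ∃ k, K = k + 1 := ⟨K - 1, by simp at hlen; omega⟩
    simp only [List.length_cons, add_le_add_iff_right] at hlen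
    simp only [List.mem_cons, forall_eq_or_imp] at hL
    obtain ⟨hq, hL⟩ := hL
    have hrec : ∀ t, u = q ++ t → L.flatten = t ++ a :: b :: v →
        SeededFact N (K + 1) (u ++ (a * b) :: v) := by
      rintro t rfl h
      obtain ⟨L', hlen', hflat', hL'⟩ := ih hlen h hL
      exact ⟨q :: L', by simpa using hlen', by simp [hflat'], by simpa using ⟨hq, hL'⟩⟩
    rw [List.flatten_cons] at hflat
    rcases List.append_eq_append_iff.1 hflat with ⟨t, h1, h2⟩ | ⟨t, rfl, h2⟩
    · exact hrec t h1 h2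
    · rcases t with _ | ⟨a', _ | ⟨b', t⟩⟩
      · exact hrec [] (by simp) (by simpa using h2.symm)
      · simp only [List.cons_append, List.nil_append, List.cons.injEq] at h2
        obtain ⟨rfl, h2⟩ := h2
        rcases L with _ | ⟨p, L⟩
        · simp at h2
        · simp only [List.mem_cons, forall_eq_or_imp] at hL
          rcases p with _ | ⟨b', p⟩
          · obtain ⟨_, _, _, h, _⟩ := hL.1
            simp at h
          · simp only [List.flatten_cons, List.cons_append, List.cons.injEq] at h2
            obtain ⟨rfl, rfl⟩ := h2
            obtain ⟨L', hlen', hflat', hL'⟩ := hq.contract_boundary hN hab hL.1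
            refine ⟨L' ++ L, ?_, ?_, ?_⟩
            · simp only [List.length_append, List.length_cons] at hlen ⊢
              omega
            · simp [hflat']
            · intro q hq
              rcases List.mem_append.1 hq with hq | hq
              · exact hL' q hq
              · exact hL.2 q hq
      · simp only [List.cons_append, List.cons.injEq] at h2
        obtain ⟨rfl, rfl, rfl⟩ := h2
        exact ⟨(u ++ (a * b) :: t) :: L, by simpa using hlen, by simp,
          by simpa using ⟨hq.contract hN, hL⟩⟩

theorem SeededFact.expand (hN : JUpward N) {K : ℕ} {u v : List M} {a b : M}
    (hab : IsBasic a b) (h : SeededFact N K (u ++ (a * b) :: v)) :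
    SeededFact N K (u ++ a :: b :: v) := by
  obtain ⟨L, hlen, hflat, hL⟩ := h
  induction L generalizing u K with
  | nil => simp at hflat
  | cons q L ih =>
    obtain ⟨K, rfl⟩ : ∃ k, K = k + 1 := ⟨K - 1, by simp at hlen; omega⟩
    simp only [List.length_cons, add_le_add_iff_right] at hlen
    simp only [List.mem_cons, forall_eq_or_imp] at hL
    obtain ⟨hq, hL⟩ := hL
    have hrec : ∀ t, u = q ++ t → L.flatten = t ++ (a * b) :: v →
        SeededFact N (K + 1) (u ++ a :: b :: v) := by
      rintro t rfl h
      obtain ⟨L', hlen', hflat', hL'⟩ := ih hlen h hL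
      exact ⟨q :: L', by simpa using hlen', by simp [hflat'], by simpa using ⟨hq, hL'⟩⟩
    rw [List.flatten_cons] at hflat
    rcases List.append_eq_append_iff.1 hflat with ⟨t, h1, h2⟩ | ⟨t, rfl, h2⟩
    · exact hrec t h1 h2
    · rcases t with _ | ⟨a', t⟩
      · exact hrec [] (by simp) (by simpa using h2.symm)
      · simp only [List.cons_append, List.cons.injEq] at h2
        obtain ⟨rfl, rfl⟩ := h2
        exact ⟨(u ++ a :: b :: t) :: L, by simpa using hlen, by simp,
          by simpa using ⟨hq.expand hN hab, hL⟩⟩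

/-- If a word containing more than `L.length` disjoint copies of `w` is cut into the blocks `L`,
then some block contains a copy of `w`. -/
theorem exists_block_contains {α : Type*} {w z : List α} (hw : w ≠ []) (L : List (List α)) :
    ∀ (t : List α) (n : ℕ), L.length < n →
      L.flatten = t ++ (List.replicate n (z ++ w)).flatten → ∃ q ∈ L, ∃ a b, q = a ++ w ++ b := by
  induction L with
  | nil =>
    intro t n hn h
    obtain ⟨n, rfl⟩ := Nat.exists_eq_succ_of_ne_zero hn.ne'
    simp [List.replicate_succ, hw] at h
  | cons q L ih =>
    intro t n hn h
    obtain ⟨n, rfl⟩ := Nat.exists_eq_succ_of_ne_zero (Nat.ne_of_gt (Nat.zero_lt_of_lt hn))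
    have hn' : L.length < n := by simpa using hn
    have hrec : ∀ t', L.flatten = t' ++ (List.replicate n (z ++ w)).flatten →
        ∃ p ∈ q :: L, ∃ a b, p = a ++ w ++ b := by
      intro t' h'
      obtain ⟨p, hp, hp'⟩ := ih t' n hn' h'
      exact ⟨p, List.mem_cons_of_mem _ hp, hp'⟩
    rw [List.replicate_succ, List.flatten_cons, List.flatten_cons, List.append_assoc,
      ← List.append_assoc] at h
    rcases List.append_eq_append_iff.1 h with ⟨t', _, h2⟩ | ⟨s, rfl, h2⟩
    · exact hrec (t' ++ w) (by rw [h2, List.append_assoc])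
    · rcases List.append_eq_append_iff.1 h2 with ⟨s', rfl, h3⟩ | ⟨s', rfl, h3⟩
      · exact ⟨_, List.mem_cons_self, t ++ z, s', by simp⟩
      · exact hrec s' h3

end SeededWords

section GreenLemmas

variable {T : Type*} [Semigroup T]

theorem exists_coe_eq_mul_coe (m : WithOne T) (s : T) : ∃ t : T, m * (s : WithOne T) = t := by
  induction m using WithOne.recOneCoe with
  | one => exact ⟨s, one_mul _⟩
  | coe a => exact ⟨a * s, (WithOne.coe_mul a s).symm⟩

theorem exists_coe_eq_coe_mul (m : WithOne T) (s : T) : ∃ t : T, (s : WithOne T) * m = t := by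
  induction m using WithOne.recOneCoe with
  | one => exact ⟨s, mul_one _⟩
  | coe a => exact ⟨s * a, (WithOne.coe_mul s a).symm⟩

theorem greenR_iff {a b : T} : GreenR a b ↔
    (∃ x : WithOne T, (a : WithOne T) * x = b) ∧ ∃ y : WithOne T, (b : WithOne T) * y = a := by
  constructor
  · rintro (rfl | ⟨x, y, rfl, h⟩)
    · exact ⟨⟨1, mul_one _⟩, 1, mul_one _⟩
    · exact ⟨⟨x, by rw [WithOne.coe_mul]⟩, y, by rw [← WithOne.coe_mul, h]⟩
  · rintro ⟨⟨x, hx⟩, y, hy⟩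
    induction x using WithOne.recOneCoe with
    | one => exact Or.inl (WithOne.coe_injective (by rw [← hx, mul_one]))
    | coe x =>
      induction y using WithOne.recOneCoe with
      | one => exact Or.inl (WithOne.coe_injective (by rw [← hy, mul_one]))
      | coe y => exact Or.inr ⟨x, y, by exact_mod_cast hx, by exact_mod_cast hy⟩

theorem greenL_iff {a b : T} : GreenL a b ↔
    (∃ x : WithOne T, x * (a : WithOne T) = b) ∧ ∃ y : WithOne T, y * (b : WithOne T) = a := by
  constructor
  · rintro (rfl | ⟨x, y, rfl, h⟩)
    · exact ⟨⟨1, one_mul _⟩, 1, one_mul _⟩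
    · exact ⟨⟨x, by rw [WithOne.coe_mul]⟩, y, by rw [← WithOne.coe_mul, h]⟩
  · rintro ⟨⟨x, hx⟩, y, hy⟩
    induction x using WithOne.recOneCoe with
    | one => exact Or.inl (WithOne.coe_injective (by rw [← hx, one_mul]))
    | coe x =>
      induction y using WithOne.recOneCoe with
      | one => exact Or.inl (WithOne.coe_injective (by rw [← hy, one_mul]))
      | coe y => exact Or.inr ⟨x, y, by exact_mod_cast hx, by exact_mod_cast hy⟩

theorem GreenR.trans {a b c : T} (h : GreenR a b) (h' : GreenR b c) : GreenR a c := by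
  rw [greenR_iff] at *
  obtain ⟨⟨x, hx⟩, y, hy⟩ := h
  obtain ⟨⟨x', hx'⟩, y', hy'⟩ := h'
  exact ⟨⟨x * x', by rw [← mul_assoc, hx, hx']⟩, y' * y, by rw [← mul_assoc, hy', hy]⟩

theorem GreenL.trans {a b c : T} (h : GreenL a b) (h' : GreenL b c) : GreenL a c := by
  rw [greenL_iff] at *
  obtain ⟨⟨x, hx⟩, y, hy⟩ := h
  obtain ⟨⟨x', hx'⟩, y', hy'⟩ := h'
  exact ⟨⟨x' * x, by rw [mul_assoc, hx, hx']⟩, y * y', by rw [mul_assoc, hy', hy]⟩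

theorem greenD_of_greenL_greenR {a c b : T} (h : GreenL a c) (h' : GreenR c b) : GreenD a b := by
  rw [greenL_iff] at h
  rw [greenR_iff] at h'
  obtain ⟨⟨x, hx⟩, y, hy⟩ := h
  obtain ⟨⟨z, hz⟩, z', hz'⟩ := h'
  obtain ⟨d, hd⟩ := exists_coe_eq_coe_mul z a
  refine ⟨d, greenR_iff.2 ⟨⟨z, hd⟩, z', ?_⟩, greenL_iff.2 ⟨⟨x, ?_⟩, y, ?_⟩⟩
  · rw [← hd, ← hy, mul_assoc, mul_assoc, ← mul_assoc (c : WithOne T), hz, hz']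
  · rw [← hd, ← mul_assoc, hx, hz]
  · rw [← hd, ← hz, ← mul_assoc, hy]

theorem GreenD.refl (a : T) : GreenD a a := ⟨a, Or.inl rfl, Or.inl rfl⟩

theorem GreenD.trans {a b c : T} (h : GreenD a b) (h' : GreenD b c) : GreenD a c := by
  obtain ⟨k, h1, h2⟩ := h
  obtain ⟨l, h3, h4⟩ := h'
  obtain ⟨d, h5, h6⟩ := greenD_of_greenL_greenR h2 h3
  exact ⟨d, h1.trans h5, h6.trans h4⟩

end GreenLemmas

section IGLemmas

variable {S : Type*} [Semigroup S]

/-- A letter, as an element of `S¹`. -/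
def valOne (e : IdemE S) : WithOne S := ((e : S) : WithOne S)

/-- A letter, as an element of `IG(E)¹`. -/
def barOne (e : IdemE S) : WithOne (IG S) := (igBar (FreeSemigroup.of e) : WithOne (IG S))

/-- The value of a possibly empty word in `S¹`. -/
def valProd (l : List (IdemE S)) : WithOne S := (l.map valOne).prod

/-- The value of a possibly empty word in `IG(E)¹`. -/
def barProd (l : List (IdemE S)) : WithOne (IG S) := (l.map barOne).prod

@[simp] theorem valProd_nil : valProd ([] : List (IdemE S)) = 1 := rfl

@[simp] theorem barProd_nil : barProd ([] : List (IdemE S)) = 1 := rfl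

@[simp] theorem valProd_cons (e : IdemE S) (l : List (IdemE S)) :
    valProd (e :: l) = valOne e * valProd l := by simp [valProd]

@[simp] theorem barProd_cons (e : IdemE S) (l : List (IdemE S)) :
    barProd (e :: l) = barOne e * barProd l := by simp [barProd]

@[simp] theorem valProd_append (l l' : List (IdemE S)) :
    valProd (l ++ l') = valProd l * valProd l' := by simp [valProd]

@[simp] theorem barProd_append (l l' : List (IdemE S)) :
    barProd (l ++ l') = barProd l * barProd l' := by simp [barProd]

theorem valOne_mul_self (e : IdemE S) : valOne e * valOne e = valOne e := by
  rw [valOne, ← WithOne.coe_mul, e.2]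

theorem igBar_mul (u v : FreeSemigroup (IdemE S)) : igBar (u * v) = igBar u * igBar v := rfl

theorem barOne_mul_barOne {e f g : IdemE S} (h : BasicPair e f) (hg : (g : S) = e * f) :
    barOne e * barOne f = barOne g := by
  rw [barOne, barOne, ← WithOne.coe_mul, ← igBar_mul]
  congr 1
  exact (Con.eq _).2 (ConGen.Rel.of _ _ ⟨e, f, g, h, hg, rfl, rfl⟩)

theorem barOne_mul_eq_left {e f : IdemE S} (h : (e : S) * f = e) :
    barOne e * barOne f = barOne e := barOne_mul_barOne (Or.inl h) h.symm

theorem barOne_mul_eq_right {e f : IdemE S} (h : (e : S) * f = f) :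
    barOne e * barOne f = barOne f := barOne_mul_barOne (Or.inr (Or.inl h)) h.symm

theorem wordList_of (e : IdemE S) : wordList (FreeSemigroup.of e) = [e] := rfl

theorem wordList_mul (u v : FreeSemigroup (IdemE S)) :
    wordList (u * v) = wordList u ++ wordList v := by
  simp [wordList]

theorem barProd_wordList (w : FreeSemigroup (IdemE S)) :
    barProd (wordList w) = (igBar w : WithOne (IG S)) := by
  induction w using FreeSemigroup.recOnMul with
  | ih1 e => simp [wordList_of, barOne]
  | ih2 e w h h' => rw [wordList_mul, barProd_append, h, h', igBar_mul, WithOne.coe_mul]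

theorem exists_wordList_eq {l : List (IdemE S)} (h : l ≠ []) :
    ∃ w : FreeSemigroup (IdemE S), wordList w = l := by
  obtain ⟨e, l, rfl⟩ := List.exists_cons_of_ne_nil h
  exact ⟨⟨e, l⟩, rfl⟩

/-- If `e 𝓡 e * v` in `S`, then `e * v` can be rewritten in `IG(E)` so that its letters lie in the
𝓓-class of `e`. -/
theorem exists_right_reduced (v : List (IdemE S)) (e : IdemE S)
    (h : ∃ y, valOne e * valProd v * y = valOne e) :
    ∃ v' : List (IdemE S),
      (∀ g ∈ v', GreenD (igBar (FreeSemigroup.of g)) (igBar (FreeSemigroup.of e))) ∧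
      barOne e * barProd v = barOne e * barProd v' ∧
      ∃ t, barOne e * barProd v * t = barOne e := by
  induction v generalizing e with
  | nil => exact ⟨[], by simp, rfl, 1, by simp⟩
  | cons f v ih =>
    obtain ⟨y, hy⟩ := h
    obtain ⟨x, hx⟩ := exists_coe_eq_mul_coe (valProd v * y) (e : S)
    have hefx : (e : S) * f * x = e := by
      apply WithOne.coe_injective
      rw [WithOne.coe_mul, WithOne.coe_mul, ← hx]
      calc valOne e * valOne f * (valProd v * y * valOne e)
          = valOne e * valProd (f :: v) * y * valOne e := by simp [mul_assoc]
        _ = valOne e := by rw [hy, valOne_mul_self]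
    have hxe : x * e = x := by
      apply WithOne.coe_injective
      rw [WithOne.coe_mul, ← hx, mul_assoc, ← WithOne.coe_mul, e.2]
    have hxx : x * (f * x) = x := by
      calc x * (f * x) = x * e * (f * x) := by rw [hxe]
        _ = x * (e * f * x) := by simp only [mul_assoc]
        _ = x := by rw [hefx, hxe]
    let g : IdemE S := ⟨f * x, by rw [mul_assoc, hxx]⟩
    have hfg : (f : S) * g = g := by
      change (f : S) * (f * x) = f * x
      rw [← mul_assoc, f.2]
    have hge : (g : S) * e = g := by
      change (f : S) * x * e = f * x
      rw [mul_assoc, hxe]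
    have heg : (e : S) * g = e := by
      change (e : S) * (f * x) = e
      rw [← mul_assoc, hefx]
    let h : IdemE S := ⟨g * f, by rw [mul_assoc, ← mul_assoc (f : S), hfg, ← mul_assoc, g.2]⟩
    have hh : (h : S) = g * f := rfl
    have hgh : (g : S) * h = h := by rw [hh, ← mul_assoc, g.2]
    have hhg : (h : S) * g = g := by rw [hh, mul_assoc, hfg, g.2]
    have hgf : barOne g * barOne f = barOne h :=
      barOne_mul_barOne (Or.inr (Or.inr (Or.inl hfg))) hh
    have hef : barOne e * barOne f = barOne e * barOne h := by
      rw [← hgf, ← mul_assoc, barOne_mul_eq_left heg]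
    have hhe : GreenD (igBar (FreeSemigroup.of h)) (igBar (FreeSemigroup.of e)) :=
      ⟨igBar (FreeSemigroup.of g),
        greenR_iff.2 ⟨⟨_, barOne_mul_eq_right hhg⟩, _, barOne_mul_eq_right hgh⟩,
        greenL_iff.2 ⟨⟨_, barOne_mul_eq_left heg⟩, _, barOne_mul_eq_left hge⟩⟩
    have hgval : valOne f * valProd v * y * valOne e = valOne g := by
      calc valOne f * valProd v * y * valOne e
          = valOne f * (valProd v * y * ((e : S) : WithOne S)) := by simp only [mul_assoc]; rfl
        _ = valOne g := by rw [hx]; exact (WithOne.coe_mul _ _).symm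
    obtain ⟨v', hv', heq, t, ht⟩ := ih h ⟨y * valOne e * valOne f, by
      have hhval : valOne h = valOne g * valOne f := WithOne.coe_mul _ _
      calc valOne h * valProd v * (y * valOne e * valOne f)
          = valOne g * (valOne f * valProd v * y * valOne e) * valOne f := by
            rw [hhval]; simp only [mul_assoc]
        _ = valOne h := by rw [hgval, valOne_mul_self, hhval]⟩
    refine ⟨h :: v', ?_, ?_, t * barOne g, ?_⟩
    · simp only [List.mem_cons, forall_eq_or_imp]
      exact ⟨hhe, fun k hk => (hv' k hk).trans hhe⟩
    · rw [barProd_cons, barProd_cons, ← mul_assoc, hef, mul_assoc, heq]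
    · calc barOne e * barProd (f :: v) * (t * barOne g)
          = barOne e * barOne f * (barProd v * t * barOne g) := by
            simp only [barProd_cons, mul_assoc]
        _ = barOne e * (barOne h * barProd v * t) * barOne g := by
            rw [hef]; simp only [mul_assoc]
        _ = barOne e := by
            rw [ht, mul_assoc, barOne_mul_eq_right hhg, barOne_mul_eq_left heg]

/-- If `u * e 𝓛 e` in `S`, then `u * e` can be rewritten in `IG(E)` so that its letters lie in the
𝓓-class of `e`. -/
theorem exists_left_reduced (u : List (IdemE S)) (e : IdemE S)
    (h : ∃ y, y * valProd u * valOne e = valOne e) :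
    ∃ u' : List (IdemE S),
      (∀ g ∈ u', GreenD (igBar (FreeSemigroup.of g)) (igBar (FreeSemigroup.of e))) ∧
      barProd u * barOne e = barProd u' * barOne e ∧
      ∃ t, t * barProd u * barOne e = barOne e := by
  induction u using List.reverseRecOn generalizing e with
  | nil => exact ⟨[], by simp, rfl, 1, by simp⟩
  | append_singleton u f ih =>
    obtain ⟨y, hy⟩ := h
    obtain ⟨x, hx⟩ := exists_coe_eq_coe_mul (y * valProd u) (e : S)
    have hxfe : x * f * (e : S) = e := by
      apply WithOne.coe_injective
      rw [WithOne.coe_mul, WithOne.coe_mul, ← hx]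
      calc valOne e * (y * valProd u) * valOne f * valOne e
          = valOne e * (y * valProd (u ++ [f]) * valOne e) := by simp [mul_assoc]
        _ = valOne e := by rw [hy, valOne_mul_self]
    have hex : (e : S) * x = x := by
      apply WithOne.coe_injective
      rw [WithOne.coe_mul, ← hx, ← mul_assoc, ← WithOne.coe_mul, e.2]
    have hxx : x * f * x = x := by
      calc x * f * x = x * f * (e * x) := by rw [hex]
        _ = x * f * e * x := by simp only [mul_assoc]
        _ = x := by rw [hxfe, hex]
    let g : IdemE S := ⟨x * f, by rw [← mul_assoc, hxx]⟩
    have hgf : (g : S) * f = g := by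
      change x * (f : S) * f = x * f
      rw [mul_assoc, f.2]
    have heg : (e : S) * g = g := by
      change (e : S) * (x * f) = x * f
      rw [← mul_assoc, hex]
    have hge : (g : S) * e = e := hxfe
    let h : IdemE S := ⟨f * g, by rw [mul_assoc, ← mul_assoc (g : S), hgf, g.2]⟩
    have hh : (h : S) = f * g := rfl
    have hhg : (h : S) * g = h := by rw [hh, mul_assoc, g.2]
    have hgh : (g : S) * h = g := by rw [hh, ← mul_assoc, hgf, g.2]
    have hfg : barOne f * barOne g = barOne h :=
      barOne_mul_barOne (Or.inr (Or.inr (Or.inr hgf))) hh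
    have hfe : barOne f * barOne e = barOne h * barOne e := by
      rw [← hfg, mul_assoc, barOne_mul_eq_right hge]
    have hhe : GreenD (igBar (FreeSemigroup.of h)) (igBar (FreeSemigroup.of e)) :=
      greenD_of_greenL_greenR (c := igBar (FreeSemigroup.of g))
        (greenL_iff.2 ⟨⟨_, barOne_mul_eq_left hgh⟩, _, barOne_mul_eq_left hhg⟩)
        (greenR_iff.2 ⟨⟨_, barOne_mul_eq_right hge⟩, _, barOne_mul_eq_right heg⟩)
    have hgval : valOne e * y * valProd u * valOne f = valOne g := by
      calc valOne e * y * valProd u * valOne f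
          = ((e : S) : WithOne S) * (y * valProd u) * valOne f := by simp only [mul_assoc]; rfl
        _ = valOne g := by rw [hx]; exact (WithOne.coe_mul _ _).symm
    obtain ⟨u', hu', heq, t, ht⟩ := ih h ⟨valOne f * valOne e * y, by
      have hhval : valOne h = valOne f * valOne g := WithOne.coe_mul _ _
      calc valOne f * valOne e * y * valProd u * valOne h
          = valOne f * ((valOne e * y * valProd u * valOne f) * valOne g) := by
            rw [hhval]; simp only [mul_assoc]
        _ = valOne h := by rw [hgval, valOne_mul_self, hhval]⟩
    refine ⟨u' ++ [h], ?_, ?_, barOne g * t, ?_⟩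
    · simp only [List.mem_append, List.mem_singleton]
      rintro k (hk | rfl)
      · exact (hu' k hk).trans hhe
      · exact hhe
    · simp only [barProd_append, barProd_cons, barProd_nil, mul_one]
      rw [mul_assoc, hfe, ← mul_assoc, heq]
    · calc barOne g * t * barProd (u ++ [f]) * barOne e
          = barOne g * t * barProd u * (barOne f * barOne e) := by simp [mul_assoc]
        _ = barOne g * (t * barProd u * barOne h) * barOne e := by
            rw [hfe]; simp only [mul_assoc]
        _ = barOne e := by
            rw [ht, barOne_mul_eq_left hgh, barOne_mul_eq_right hge]

/-- Whether a word factorises into few seeded words depends only on its value in `IG(E)`. -/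
theorem seededFact_iff_of_igBar_eq {N : WithOne S → Prop} (hN : JUpward N) (K : ℕ)
    {w w' : FreeSemigroup (IdemE S)} (h : igBar w = igBar w') :
    SeededFact N K ((wordList w).map valOne) ↔ SeededFact N K ((wordList w').map valOne) := by
  have key : ∀ w w' : FreeSemigroup (IdemE S), ConGen.Rel (fun u v => igRelBase u v) w w' →
      ∀ u v : List (WithOne S), SeededFact N K (u ++ (wordList w).map valOne ++ v) ↔
        SeededFact N K (u ++ (wordList w').map valOne ++ v) := by
    intro w w' h
    induction h with
    | of w w' h =>
      intro u v
      obtain ⟨e, f, g, hef, hg, rfl, rfl⟩ := h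
      have hgval : valOne g = valOne e * valOne f := by
        rw [valOne, hg, WithOne.coe_mul]; rfl
      have hbasic : IsBasic (valOne e) (valOne f) := by
        refine ⟨valOne_mul_self e, valOne_mul_self f, ?_⟩
        simp only [valOne, ← WithOne.coe_mul, WithOne.coe_inj]
        exact hef
      have hl : u ++ (wordList (FreeSemigroup.of e * FreeSemigroup.of f)).map valOne ++ v =
          u ++ valOne e :: valOne f :: v := by simp [wordList_mul, wordList_of]
      have hr : u ++ (wordList (FreeSemigroup.of g)).map valOne ++ v =
          u ++ (valOne e * valOne f) :: v := by simp [wordList_of, hgval]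
      rw [hl, hr]
      exact ⟨SeededFact.contract hN hbasic, SeededFact.expand hN hbasic⟩
    | refl w => exact fun u v => Iff.rfl
    | symm _ ih => exact fun u v => (ih u v).symm
    | trans _ _ ih ih' => exact fun u v => (ih u v).trans (ih' u v)
    | @mul _ x _ _ _ _ ih ih' =>
      intro u v
      have h1 := ih u
      have h2 := fun u => ih' u v
      simp only [wordList_mul, List.map_append, List.append_assoc] at h1 h2 ⊢
      rw [h1]
      simpa only [List.append_assoc] using h2 (u ++ (wordList x).map valOne)
  simpa using key w w' ((Con.eq _).1 h) [] []

theorem valProd_eq_prod_map (l : List (IdemE S)) : (l.map valOne).prod = valProd l := rfl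

theorem finite_idempotents_withOne [Finite (IdemE S)] :
    {x : WithOne S | x * x = x}.Finite := by
  refine ((Set.finite_range (valOne (S := S))).union (Set.finite_singleton 1)).subset ?_
  intro x hx
  induction x using WithOne.recOneCoe with
  | one => simp
  | coe a => exact Or.inl ⟨⟨a, WithOne.coe_injective ((WithOne.coe_mul a a).trans hx)⟩, rfl⟩

theorem exists_seed_of_isRegularElem [Finite (IdemE S)] {w : FreeSemigroup (IdemE S)}
    (hw : IsRegularElem (igBar w)) :
    ∃ u e v, wordList w = u ++ e :: v ∧ (∃ x, x * valProd u * valOne e = valOne e) ∧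
      ∃ y, valOne e * valProd v * y = valOne e := by
  let N : WithOne S → Prop := fun e => ¬ ∃ x y, x * valProd (wordList w) * y = e
  have hN : JUpward N := by
    rintro g x y h ⟨x', y', rfl⟩
    exact h ⟨x * x', y' * y, by simp only [mul_assoc]⟩
  by_cases hex : ∃ e ∈ wordList w, ¬ N (valOne e)
  · obtain ⟨e, hmem, he⟩ := hex
    obtain ⟨x, y, hxy⟩ := not_not.1 he
    obtain ⟨u, v, huv⟩ := List.append_of_mem hmem
    refine ⟨u, e, v, huv,
      stable_of_finite_idempotents finite_idempotents_withOne (valOne_mul_self e)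
        (x := x) (y := y) ?_⟩
    rw [huv] at hxy
    simpa [mul_assoc] using hxy
  · exfalso
    push Not at hex
    obtain ⟨b, hb⟩ := hw
    obtain ⟨z, rfl⟩ : ∃ z, igBar z = b := Quot.exists_rep b
    set W := (wordList w).map valOne with hW
    set Z := (wordList z).map valOne
    have hWne : W ≠ [] := by simp [hW, wordList]
    have hfact : SeededFact N (wordList w).length W := by
      refine ⟨W.map fun a => [a], by simp [hW], by rw [← List.flatMap_def, List.flatMap_singleton'], ?_⟩
      intro q hq
      simp only [hW, List.map_map, List.mem_map, Function.comp_apply] at hq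
      obtain ⟨e, he, rfl⟩ := hq
      exact ⟨[], valOne e, [], rfl, hex e he, ⟨1, by simp⟩, 1, by simp⟩
    have hpow : ∀ n, ∃ w' : FreeSemigroup (IdemE S), igBar w' = igBar w ∧
        (wordList w').map valOne = W ++ (List.replicate n (Z ++ W)).flatten := by
      intro n
      induction n with
      | zero => exact ⟨w, rfl, by simp [hW]⟩
      | succ n ih =>
        obtain ⟨w', hw', hl⟩ := ih
        refine ⟨w' * z * w, by rw [igBar_mul, igBar_mul, hw', hb], ?_⟩
        rw [wordList_mul, wordList_mul, List.map_append, List.map_append, hl,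
          List.replicate_succ', List.flatten_append, List.flatten_singleton]
        simp only [List.append_assoc]
        rfl
    obtain ⟨w', hw', hl⟩ := hpow ((wordList w).length + 1)
    obtain ⟨L, hlen, hflat, hL⟩ :=
      (seededFact_iff_of_igBar_eq hN (wordList w).length hw').2 hfact
    obtain ⟨q, hq, a, c, rfl⟩ := exists_block_contains hWne L W _
      (Nat.lt_succ_of_le hlen) (hflat.trans hl)
    obtain ⟨u, e, v, huv, he, ⟨x, hx⟩, y, hy⟩ := hL _ hq
    refine he ⟨x * a.prod, c.prod * y, ?_⟩
    have hprod := congrArg List.prod huv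
    simp only [List.prod_append, List.prod_cons] at hprod
    calc x * a.prod * valProd (wordList w) * (c.prod * y)
        = x * (a.prod * W.prod * c.prod) * y := by
          rw [hW, valProd_eq_prod_map]; simp only [mul_assoc]
      _ = x * u.prod * (e * v.prod * y) := by rw [hprod]; simp only [mul_assoc]
      _ = e := by rw [hy, hx]

/-- Every letter of `q` is 𝓓-related to `q` in `IG(E)`. -/
def LettersInDClass (q : FreeSemigroup (IdemE S)) : Prop :=
  ∀ e ∈ wordList q, GreenD (igBar (FreeSemigroup.of e)) (igBar q)

/-- A regular element of `IG(E)` is represented by a word with letters in its 𝓓-class. -/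
theorem exists_lettersInDClass [Finite (IdemE S)] {w : FreeSemigroup (IdemE S)}
    (hw : IsRegularElem (igBar w)) : ∃ q, igBar q = igBar w ∧ LettersInDClass q := by
  obtain ⟨u, e, v, huv, hu, hv⟩ := exists_seed_of_isRegularElem hw
  obtain ⟨u', hu', hueq, s, hs⟩ := exists_left_reduced u e hu
  obtain ⟨v', hv', hveq, t, ht⟩ := exists_right_reduced v e hv
  obtain ⟨q, hq⟩ := exists_wordList_eq (l := u' ++ e :: v') (by simp)
  have hwbar : (igBar w : WithOne (IG S)) = barProd u * (barOne e * barProd v) := by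
    rw [← barProd_wordList, huv, barProd_append, barProd_cons]
  have hqw : igBar q = igBar w := by
    apply WithOne.coe_injective
    rw [hwbar, ← barProd_wordList, hq, barProd_append, barProd_cons, hveq, ← mul_assoc,
      ← mul_assoc, hueq]
  have hew : GreenD (igBar (FreeSemigroup.of e)) (igBar w) := by
    obtain ⟨c, hc⟩ := exists_coe_eq_coe_mul (barProd v) (igBar (FreeSemigroup.of e))
    refine ⟨c, greenR_iff.2 ⟨⟨_, hc⟩, t, ?_⟩, greenL_iff.2 ⟨⟨barProd u, ?_⟩, s, ?_⟩⟩
    · rw [← hc]; exact ht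
    · rw [← hc, hwbar]; rfl
    · rw [← hc, hwbar]
      calc s * (barProd u * (barOne e * barProd v)) = s * barProd u * barOne e * barProd v := by
            simp only [mul_assoc]
        _ = barOne e * barProd v := by rw [hs]
  refine ⟨q, hqw, fun g hg => ?_⟩
  rw [hqw]
  rw [hq, List.mem_append, List.mem_cons] at hg
  rcases hg with hg | rfl | hg
  · exact (hu' g hg).trans hew
  · exact hew
  · exact (hv' g hg).trans hew

theorem coe_blockProd {T : Type*} [Semigroup T] (p : ℕ → T) (i k : ℕ) :
    ((blockProd p i k : T) : WithOne T) =
      ((List.range' i (k + 1)).map fun n => (p n : WithOne T)).prod := by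
  induction k with
  | zero => simp [blockProd]
  | succ k ih =>
    rw [blockProd, WithOne.coe_mul, ih, List.range'_concat (n := k + 1)]
    simp

theorem isRegularElem_letter (e : IdemE S) : IsRegularElem (igBar (FreeSemigroup.of e)) := by
  refine ⟨igBar (FreeSemigroup.of e), WithOne.coe_injective ?_⟩
  have h : barOne e * barOne e = barOne e := barOne_mul_eq_left e.2
  rw [WithOne.coe_mul, WithOne.coe_mul]
  change barOne e * barOne e * barOne e = barOne e
  rw [h, h]

/-- The product in `IG(E)¹` of a list of words. -/
def factProd (L : List (FreeSemigroup (IdemE S))) : WithOne (IG S) :=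
  (L.map fun q => (igBar q : WithOne (IG S))).prod

theorem igBar_blockProd_getD (L : List (FreeSemigroup (IdemE S))) (d : FreeSemigroup (IdemE S))
    (i k : ℕ) (h : i + k < L.length) :
    (igBar (blockProd (fun n => L.getD (n - 1) d) (i + 1) k) : WithOne (IG S)) =
      factProd ((L.drop i).take (k + 1)) := by
  have hmap : ∀ k, igBar (blockProd (fun n => L.getD (n - 1) d) (i + 1) k) =
      blockProd (fun n => igBar (L.getD (n - 1) d)) (i + 1) k := by
    intro k
    induction k with
    | zero => rfl
    | succ k ih => rw [blockProd, igBar_mul, ih, blockProd]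
  rw [hmap, coe_blockProd, factProd]
  congr 1
  refine List.ext_getElem ?_ ?_
  · simp; omega
  · intro n h1 h2
    simp only [List.length_map, List.length_range'] at h1
    have hn : i + n < L.length := by omega
    have hi : i + 1 + n - 1 = i + n := by omega
    simp [hi, hn]

theorem exists_minimal_factors [Finite (IdemE S)] (w : FreeSemigroup (IdemE S)) :
    ∃ L : List (FreeSemigroup (IdemE S)), L ≠ [] ∧ factProd L = igBar w ∧
      (∀ q ∈ L, IsRegularElem (igBar q) ∧ LettersInDClass q) ∧
      ∀ A B C, L = A ++ B ++ C → 2 ≤ B.length →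
        ∀ b : FreeSemigroup (IdemE S), factProd B = igBar b → ¬ IsRegularElem (igBar b) := by
  classical
  let P : ℕ → Prop := fun m => ∃ L : List (FreeSemigroup (IdemE S)), L ≠ [] ∧
    factProd L = igBar w ∧ (∀ q ∈ L, IsRegularElem (igBar q) ∧ LettersInDClass q) ∧ L.length = m
  have hP : ∃ m, P m := by
    refine ⟨_, (wordList w).map FreeSemigroup.of, by simp [wordList], ?_, ?_, rfl⟩
    · rw [← barProd_wordList, factProd, List.map_map]; rfl
    · intro q hq
      obtain ⟨e, -, rfl⟩ := List.mem_map.1 hq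
      refine ⟨isRegularElem_letter e, fun f hf => ?_⟩
      rw [wordList_of, List.mem_singleton] at hf
      exact hf ▸ GreenD.refl _
  obtain ⟨L, hne, hprod, hL, hlen⟩ := Nat.find_spec hP
  refine ⟨L, hne, hprod, hL, ?_⟩
  rintro A B C rfl hB b hb hreg
  obtain ⟨q, hq, hqD⟩ := exists_lettersInDClass hreg
  refine Nat.find_min hP (m := (A ++ [q] ++ C).length) ?_ ⟨A ++ [q] ++ C, by simp, ?_, ?_, rfl⟩
  · rw [← hlen]
    simp only [List.length_append, List.length_singleton]
    omega
  · rw [← hprod]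
    simp only [factProd, List.map_append, List.prod_append, List.map_singleton,
      List.prod_singleton] at hb ⊢
    rw [hb, hq]
  · intro p hp
    simp only [List.mem_append, List.mem_singleton] at hp
    rcases hp with (hp | rfl) | hp
    · exact hL p (by simp [hp])
    · exact ⟨hq ▸ hreg, hqD⟩
    · exact hL p (by simp [hp])

end IGLemmas

theorem stmt17 {S : Type*} [Semigroup S] [Finite (IdemE S)]
    (w : FreeSemigroup (IdemE S)) :
    ∃ w' : FreeSemigroup (IdemE S), igBar w = igBar w' ∧
      ∃ (m : ℕ) (p : ℕ → FreeSemigroup (IdemE S)), IsMinRFact w' m p ∧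
        ∀ i, 1 ≤ i → i ≤ m → ∀ e ∈ wordList (p i),
          GreenD (igBar (FreeSemigroup.of e)) (igBar (p i)) := by
  obtain ⟨L, hne, hprod, hL, hmin⟩ := exists_minimal_factors w
  have hpos : 0 < L.length := List.length_pos_of_ne_nil hne
  have hmem : ∀ i, 1 ≤ i → i ≤ L.length → L.getD (i - 1) w ∈ L := by
    intro i h1 h2
    rw [List.getD_eq_getElem _ _ (by omega)]
    exact List.getElem_mem _
  refine ⟨blockProd (fun n => L.getD (n - 1) w) 1 (L.length - 1), ?_, L.length,
    fun n => L.getD (n - 1) w,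
    ⟨⟨hpos, rfl, fun i h1 h2 => (hL _ (hmem i h1 h2)).1⟩, ?_⟩,
    fun i h1 h2 => (hL _ (hmem i h1 h2)).2⟩
  · apply WithOne.coe_injective
    have h := igBar_blockProd_getD L w 0 (L.length - 1) (by omega)
    rw [List.drop_zero, List.take_of_length_le (by omega), hprod] at h
    exact h.symm
  · intro i j hi hij hj
    obtain ⟨i, rfl⟩ : ∃ k, i = k + 1 := ⟨i - 1, by omega⟩
    refine hmin (L.take i) ((L.drop i).take (j - (i + 1) + 1))
      ((L.drop i).drop (j - (i + 1) + 1)) ?_ ?_ _ (igBar_blockProd_getD L w i _ (by omega)).symm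
    · rw [List.append_assoc, List.take_append_drop, List.take_append_drop]
    · simp only [List.length_take, List.length_drop]
      omega
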